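/- Suppose max(1 − 1/α, 0) < β < 1, all moments of L are finite, n P(H > M_n) → ∞, n P(H > M_n)^{2−β} (log M_n)² → 0, and the tail of H is second order regularly varying with second order parameter ρ < −(1−β)/β. Then Assumption A holds: there exists a sequence (ε_n) of positive numbers such that P(H > M_n)^{−(1−β)} ε_n → 0, n P(H > M_n) P(L > ε_n M_n) → 0, and P(H > M_n)^{−(1−β)} (l(γM_n(1+ε_n))/l(γM_n) − 1) → 0, where l(x) := x^α P(H > x). -/

import Mathlib

open MeasureTheory ProbabilityTheory Filter Topology Set Asymptotics

noncomputable section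

variable {Ω : Type*} [MeasureSpace Ω]

/-- The `k`-th largest order statistic (1-indexed) of the finite sample `f`,
so `orderStat f 1 ≥ orderStat f 2 ≥ … ≥ orderStat f n`. -/
def orderStat {n : ℕ} (f : Fin n → ℝ) (k : ℕ) : ℝ :=
  if h : n - k < n then f (Tuple.sort f ⟨n - k, h⟩) else 0

/-- The Hill statistic `h(k,n) = (1/k) ∑_{i=1}^k log (X_{(i)} / X_{(k)})`. -/
def hill {n : ℕ} (f : Fin n → ℝ) (k : ℕ) : ℝ :=
  (k : ℝ)⁻¹ * ∑ i ∈ Finset.Icc 1 k, Real.log (orderStat f i / orderStat f k)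

/-- Tail probability `x ↦ P(Z > x)`. -/
def tailP (Z : Ω → ℝ) (x : ℝ) : ℝ := (ℙ {ω | Z ω > x}).toReal

/-- `b(y) := inf {x : 1/P(H > x) ≥ y}`. -/
def bq (Z : Ω → ℝ) (y : ℝ) : ℝ := sInf {x : ℝ | 1 / tailP Z x ≥ y}

/-- `l(x) := x^α P(H > x)`. -/
def ell (α : ℝ) (Z : Ω → ℝ) (x : ℝ) : ℝ := x ^ α * tailP Z x

/-- The tail of `H` is regularly varying with index `-α`. -/
def RegVarTail (H0 : Ω → ℝ) (α : ℝ) : Prop :=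
  ∀ x : ℝ, 0 < x → Tendsto (fun t => tailP H0 (t * x) / tailP H0 t) atTop (𝓝 (x ^ (-α)))

/-- A function is regularly varying (at infinity) with index `σ`. -/
def RegVarFun (A : ℝ → ℝ) (σ : ℝ) : Prop :=
  ∀ x : ℝ, 0 < x → Tendsto (fun t => A (t * x) / A t) atTop (𝓝 (x ^ σ))

/-- Second order regular variation of the tail of `H`, with auxiliary function `A`:
`lim_{t→∞} [(P(H > tx)/P(H > t) - x^{-α})/A(t)] = x^{-α} (x^{ρα} - 1)/(ρ/α)` for all `x > 0`. -/
def SecondOrderRVTail (H0 : Ω → ℝ) (α ρ : ℝ) (A : ℝ → ℝ) : Prop :=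
  ∀ x : ℝ, 0 < x →
    Tendsto (fun t => (tailP H0 (t * x) / tailP H0 t - x ^ (-α)) / A t) atTop
      (𝓝 (x ^ (-α) * (x ^ (ρ * α) - 1) / (ρ / α)))

open Real in
/-- A function bounded near infinity that shrinks by `2 ^ (-σ)` at each doubling decays like
`t ^ (-σ)`. -/
lemma le_rpow_neg_of_doubling {f : ℝ → ℝ} {T K σ : ℝ} (hT : 0 < T) (hK : 0 ≤ K) (hσ : 0 < σ)
    (hbd : ∀ t, T ≤ t → f t ≤ K)
    (hstep : ∀ t, T ≤ t → f (t * 2) ≤ (2 : ℝ) ^ (-σ) * f t) {t : ℝ} (ht : T ≤ t) :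
    f t ≤ K * (2 * T) ^ σ * t ^ (-σ) := by
  have base : ∀ t, T ≤ t → t ≤ 2 * T → f t ≤ K * (2 * T) ^ σ * t ^ (-σ) := by
    intro t h1 h2
    have ht0 : 0 < t := hT.trans_le h1
    have h3 : 1 ≤ (2 * T) ^ σ * t ^ (-σ) := by
      rw [rpow_neg ht0.le, ← div_eq_mul_inv, one_le_div (rpow_pos_of_pos ht0 _)]
      exact rpow_le_rpow ht0.le h2 hσ.le
    calc f t ≤ K := hbd t h1
      _ ≤ K * ((2 * T) ^ σ * t ^ (-σ)) := le_mul_of_one_le_right hK h3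
      _ = _ := by ring
  have key : ∀ k : ℕ, ∀ t, T ≤ t → t ≤ 2 ^ k * (2 * T) →
      f t ≤ K * (2 * T) ^ σ * t ^ (-σ) := by
    intro k
    induction k with
    | zero => intro t h1 h2; exact base t h1 (by simpa using h2)
    | succ k ih =>
      intro t h1 h2
      rcases le_total t (2 * T) with h | h
      · exact base t h1 h
      · have h3 : T ≤ t / 2 := by linarith
        have h4 := ih (t / 2) h3 (by rw [pow_succ] at h2; linarith)
        have h5 := hstep (t / 2) h3
        rw [div_mul_cancel₀ t two_ne_zero] at h5
        have h6 : (2 : ℝ) ^ (-σ) * (t / 2) ^ (-σ) = t ^ (-σ) := by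
          rw [← mul_rpow (by norm_num) (by linarith)]
          congr 1
          ring
        calc f t ≤ (2 : ℝ) ^ (-σ) * f (t / 2) := h5
          _ ≤ (2 : ℝ) ^ (-σ) * (K * (2 * T) ^ σ * (t / 2) ^ (-σ)) := by gcongr
          _ = K * (2 * T) ^ σ * ((2 : ℝ) ^ (-σ) * (t / 2) ^ (-σ)) := by ring
          _ = _ := by rw [h6]
  obtain ⟨k, hk⟩ := pow_unbounded_of_one_lt (t / (2 * T)) (one_lt_two (α := ℝ))
  exact key k t ht ((div_le_iff₀ (by linarith)).1 hk.le)

open Real in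
/-- If `g` is slowly varying in the additive sense and its increments over doublings are
`O(t ^ (-σ))`, then all its forward increments are `O(t ^ (-σ))`, uniformly. -/
lemma abs_sub_le_rpow_neg_of_doubling {g : ℝ → ℝ} {T C σ : ℝ} (hT : 0 < T) (hC : 0 ≤ C)
    (hσ : 0 < σ) (hstep : ∀ t, T ≤ t → |g (t * 2) - g t| ≤ C * t ^ (-σ))
    (hslow : ∀ x, 0 < x → Tendsto (fun t => g (t * x) - g t) atTop (𝓝 0))
    {t x : ℝ} (ht : T ≤ t) (hx : 1 ≤ x) :
    |g (t * x) - g t| ≤ 2 * (C / (1 - (2 : ℝ) ^ (-σ))) * t ^ (-σ) := by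
  have hq : (2 : ℝ) ^ (-σ) < 1 := rpow_lt_one_of_one_lt_of_neg one_lt_two (by linarith)
  set q : ℝ := (2 : ℝ) ^ (-σ) with hqdef
  set D := C / (1 - q) with hD
  have hD0 : 0 ≤ D := div_nonneg hC (by linarith)
  have hDC : D * q + C = D := by
    have : D * (1 - q) = C := div_mul_cancel₀ C (by linarith)
    linarith
  have key : ∀ k : ℕ, ∀ t, T ≤ t → |g (t * 2 ^ k) - g t| ≤ D * t ^ (-σ) := by
    intro k
    induction k with
    | zero =>
      intro t h1
      have := rpow_nonneg (hT.le.trans h1) (-σ)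
      simpa using mul_nonneg hD0 this
    | succ k ih =>
      intro t h1
      have ht0 : 0 < t := hT.trans_le h1
      have h2 := ih (t * 2) (by linarith)
      rw [mul_rpow ht0.le (by norm_num), ← hqdef] at h2
      have h3 := hstep t h1
      have h4 : t * 2 ^ (k + 1) = t * 2 * 2 ^ k := by ring
      rw [h4]
      calc |g (t * 2 * 2 ^ k) - g t|
          ≤ |g (t * 2 * 2 ^ k) - g (t * 2)| + |g (t * 2) - g t| := abs_sub_le _ _ _
        _ ≤ D * (t ^ (-σ) * q) + C * t ^ (-σ) := add_le_add h2 h3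
        _ = (D * q + C) * t ^ (-σ) := by ring
        _ = _ := by rw [hDC]
  have ht0 : 0 < t := hT.trans_le ht
  have htx : t ≤ t * x := le_mul_of_one_le_right ht0.le hx
  have hmono : (t * x) ^ (-σ) ≤ t ^ (-σ) :=
    rpow_le_rpow_of_nonpos ht0 htx (by linarith)
  have hlim : Tendsto (fun k : ℕ => |g (t * 2 ^ k * x) - g (t * 2 ^ k)| + 2 * D * t ^ (-σ))
      atTop (𝓝 (0 + 2 * D * t ^ (-σ))) := by
    have h1 : Tendsto (fun k : ℕ => t * (2 : ℝ) ^ k) atTop atTop :=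
      (tendsto_pow_atTop_atTop_of_one_lt one_lt_two).const_mul_atTop ht0
    have h2 := ((hslow x (by linarith)).comp h1).abs
    rw [abs_zero] at h2
    exact h2.add_const _
  rw [zero_add] at hlim
  refine ge_of_tendsto' hlim fun k => ?_
  have h1 := key k t ht
  have h2 := (key k (t * x) (ht.trans htx)).trans (mul_le_mul_of_nonneg_left hmono hD0)
  rw [mul_right_comm] at h2
  have h3 := abs_sub_le (g (t * x)) (g (t * 2 ^ k * x)) (g t)
  have h4 := abs_sub_le (g (t * 2 ^ k * x)) (g (t * 2 ^ k)) (g t)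
  rw [abs_sub_comm] at h2
  linarith

open Real in
/-- Second order regular variation with negative second order index makes the forward increments
of the logarithm of the slowly varying part decay at a power rate. -/
lemma exists_abs_log_sub_le_of_secondOrder {F A : ℝ → ℝ} {α ρ σ : ℝ} (hα : 0 < α) (hρ : ρ < 0)
    (hσ : 0 < σ) (hσρ : σ < -(ρ * α)) (hF : ∀ t, 0 < F t) (hFanti : Antitone F)
    (hreg : ∀ x : ℝ, 0 < x → Tendsto (fun t => F (t * x) / F t) atTop (𝓝 (x ^ (-α))))
    (hApos : ∀ t, 0 < t → 0 < A t) (hA : RegVarFun A (ρ * α))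
    (hsnd : Tendsto (fun t => (F (t * 2) / F t - 2 ^ (-α)) / A t) atTop
      (𝓝 (2 ^ (-α) * (2 ^ (ρ * α) - 1) / (ρ / α)))) :
    ∃ T K : ℝ, 0 < T ∧ 0 ≤ K ∧ ∀ t, T ≤ t → ∀ x, 1 ≤ x →
      |log ((t * x) ^ α * F (t * x)) - log (t ^ α * F t)| ≤ K * t ^ (-σ) := by
  have h2α : 0 < (2 : ℝ) ^ (-α) := by positivity
  have h2α1 : (2 : ℝ) ^ (-α) < 1 := rpow_lt_one_of_one_lt_of_neg one_lt_two (by linarith)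
  set c : ℝ := 2 ^ (-α) * (2 ^ (ρ * α) - 1) / (ρ / α) with hc
  have hc0 : 0 < c := by
    have : (2 : ℝ) ^ (ρ * α) < 1 :=
      rpow_lt_one_of_one_lt_of_neg one_lt_two (mul_neg_of_neg_of_pos hρ hα)
    exact div_pos_of_neg_of_neg (mul_neg_of_pos_of_neg h2α (by linarith))
      (div_neg_of_neg_of_pos hρ hα)
  have hAstep : ∀ᶠ t in atTop, A (t * 2) / A t < 2 ^ (-σ) :=
    (hA 2 two_pos).eventually_lt_const (rpow_lt_rpow_of_exponent_lt one_lt_two (by linarith))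
  obtain ⟨T₁, hT₁⟩ := eventually_atTop.1 (hAstep.and ((hsnd.eventually_const_lt
    (half_lt_self hc0)).and (hsnd.eventually_lt_const (show c < 2 * c by linarith))))
  set T₀ := max T₁ 1
  have hT₀ : 0 < T₀ := zero_lt_one.trans_le (le_max_right _ _)
  have hquot : ∀ t, T₀ ≤ t → c / 2 * A t < F (t * 2) / F t - 2 ^ (-α) ∧
      F (t * 2) / F t - 2 ^ (-α) < 2 * c * A t := by
    intro t ht
    have := hApos t (hT₀.trans_le ht)
    obtain ⟨-, h1, h2⟩ := hT₁ t ((le_max_left _ _).trans ht)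
    exact ⟨(lt_div_iff₀ this).1 h1, (div_lt_iff₀ this).1 h2⟩
  have hAbd : ∀ t, T₀ ≤ t → A t ≤ 2 / c := by
    intro t ht
    have ht0 := hT₀.trans_le ht
    have h1 : F (t * 2) / F t ≤ 1 := (div_le_one (hF t)).2 (hFanti (by linarith))
    have h2 := (hquot t ht).1
    rw [le_div_iff₀ hc0]
    nlinarith
  have hAdec : ∀ t, T₀ ≤ t → A t ≤ 2 / c * (2 * T₀) ^ σ * t ^ (-σ) := fun t ht =>
    le_rpow_neg_of_doubling hT₀ (by positivity) hσ hAbd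
      (fun s hs => ((div_lt_iff₀ (hApos s (hT₀.trans_le hs))).1
        (hT₁ s ((le_max_left _ _).trans hs)).1).le) ht
  set l : ℝ → ℝ := fun t => t ^ α * F t with hl
  have hlpos : ∀ t, 0 < t → 0 < l t := fun t ht => mul_pos (rpow_pos_of_pos ht _) (hF t)
  have hlquot : ∀ t, 0 < t → ∀ x, 0 < x → l (t * x) / l t = x ^ α * (F (t * x) / F t) := by
    intro t ht x hx
    have := (hF t).ne'
    have := (rpow_pos_of_pos ht α).ne'
    simp only [hl]
    rw [mul_rpow ht.le hx.le]
    field_simp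
  have hlog : ∀ t, 0 < t → ∀ x, 0 < x →
      log (l (t * x)) - log (l t) = log (l (t * x) / l t) := fun t ht x hx =>
    (log_div (hlpos _ (mul_pos ht hx)).ne' (hlpos t ht).ne').symm
  have hslow : ∀ x, 0 < x → Tendsto (fun t => log (l (t * x)) - log (l t)) atTop (𝓝 0) := by
    intro x hx
    have h1 : Tendsto (fun t => x ^ α * (F (t * x) / F t)) atTop (𝓝 1) := by
      have := (hreg x hx).const_mul (x ^ α)
      rwa [← rpow_add hx, add_neg_cancel, rpow_zero] at this
    have h2 := h1.log one_ne_zero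
    rw [log_one] at h2
    refine h2.congr' ?_
    filter_upwards [eventually_gt_atTop 0] with t ht
    rw [hlog t ht x hx, hlquot t ht x hx]
  set C : ℝ := 2 ^ α * (2 * c) * (2 / c * (2 * T₀) ^ σ) with hCdef
  refine ⟨T₀, _, hT₀, ?_, fun t ht x hx => abs_sub_le_rpow_neg_of_doubling
    (g := fun t => log (l t)) (C := C) hT₀ (by positivity) hσ ?_ hslow ht hx⟩
  · have : (2 : ℝ) ^ (-σ) < 1 := rpow_lt_one_of_one_lt_of_neg one_lt_two (by linarith)
    have hC0 : 0 ≤ C := by positivity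
    have := div_nonneg hC0 (by linarith : 0 ≤ 1 - (2 : ℝ) ^ (-σ))
    positivity
  · intro t ht
    have ht0 := hT₀.trans_le ht
    obtain ⟨h1, h2⟩ := hquot t ht
    have hA0 := hApos t ht0
    have hid : (2 : ℝ) ^ α * 2 ^ (-α) = 1 := by
      rw [← rpow_add two_pos, add_neg_cancel, rpow_zero]
    have h3 : l (t * 2) / l t - 1 = 2 ^ α * (F (t * 2) / F t - 2 ^ (-α)) := by
      rw [hlquot t ht0 2 two_pos, mul_sub, hid]
    have h2a : 0 < (2 : ℝ) ^ α := by positivity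
    have h4 : 1 ≤ l (t * 2) / l t := by
      have : 0 ≤ 2 ^ α * (F (t * 2) / F t - 2 ^ (-α)) :=
        mul_nonneg h2a.le ((by positivity : 0 ≤ c / 2 * A t).trans h1.le)
      linarith
    rw [hlog t ht0 2 two_pos, abs_of_nonneg (log_nonneg h4)]
    calc log (l (t * 2) / l t) ≤ l (t * 2) / l t - 1 := log_le_sub_one_of_pos (by linarith)
      _ = 2 ^ α * (F (t * 2) / F t - 2 ^ (-α)) := h3
      _ ≤ 2 ^ α * (2 * c * A t) := by gcongr
      _ ≤ 2 ^ α * (2 * c * (2 / c * (2 * T₀) ^ σ * t ^ (-σ))) := by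
          gcongr; exact hAdec t ht
      _ = _ := by rw [hCdef]; ring

lemma tailP_antitone {Ω : Type*} [MeasureSpace Ω] [IsFiniteMeasure (ℙ : Measure Ω)]
    (Z : Ω → ℝ) : Antitone (tailP Z) := fun _ _ hxy =>
  ENNReal.toReal_mono (measure_ne_top _ _) (measure_mono fun _ hω => lt_of_le_of_lt hxy hω)

lemma tailP_le_integral_pow_div {Ω : Type*} [MeasureSpace Ω] [IsFiniteMeasure (ℙ : Measure Ω)]
    {Z : Ω → ℝ} (hZ : ∀ ω, 0 ≤ Z ω) {k : ℕ} (hint : Integrable (fun ω => Z ω ^ k) ℙ)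
    {y : ℝ} (hy : 0 < y) : tailP Z y ≤ (∫ ω, Z ω ^ k) / y ^ k := by
  rw [le_div_iff₀ (pow_pos hy k), mul_comm]
  refine le_trans ?_ (mul_meas_ge_le_integral_of_nonneg
    (ae_of_all _ fun ω => pow_nonneg (hZ ω) k) hint (y ^ k))
  refine mul_le_mul_of_nonneg_left ?_ (pow_pos hy k).le
  exact measureReal_mono (fun ω (hω : y < Z ω) => pow_le_pow_left₀ hy.le hω.le k)

/-- If `max(1 - 1/α, 0) < β < 1`, all moments of `L` are finite, Assumptions B and C hold,
and the tail of `H` is second order regularly varying with `ρ < -(1-β)/β`, then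
Assumption A holds. -/
theorem second_order_implies_assumption_A
    {Ω : Type*} [MeasureSpace Ω] [IsProbabilityMeasure (ℙ : Measure Ω)]
    (H0 L0 : Ω → ℝ) (hH0meas : Measurable H0) (hL0meas : Measurable L0)
    (hH0nn : ∀ ω, 0 ≤ H0 ω) (hL0nn : ∀ ω, 0 ≤ L0 ω)
    (α β γ : ℝ) (hα : 0 < α) (hγ : γ ∈ Ioo (0:ℝ) 1)
    (hβl : max (1 - 1 / α) 0 < β) (hβu : β < 1)
    (hreg : RegVarTail H0 α)
    (M : ℕ → ℝ) (hMpos : ∀ n, 0 < M n) (hMtop : Tendsto M atTop atTop)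
    (hLmom : ∀ p : ℕ, Integrable (fun ω => L0 ω ^ p) (ℙ : Measure Ω))
    (hB : Tendsto (fun n : ℕ => (n : ℝ) * tailP H0 (M n)) atTop atTop)
    (hC : Tendsto (fun n : ℕ => (n : ℝ) * tailP H0 (M n) ^ (2 - β) * Real.log (M n) ^ 2)
      atTop (𝓝 0))
    (ρ : ℝ) (hρ : ρ < 0) (hρβ : ρ < -((1 - β) / β))
    (hsnd : ∃ A : ℝ → ℝ, (∀ t, 0 < t → 0 < A t) ∧ RegVarFun A (ρ * α) ∧
      SecondOrderRVTail H0 α ρ A) :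
    ∃ ε : ℕ → ℝ, (∀ n, 0 < ε n) ∧
      Tendsto (fun n : ℕ => tailP H0 (M n) ^ (-(1 - β)) * ε n) atTop (𝓝 0) ∧
      Tendsto (fun n : ℕ => (n : ℝ) * tailP H0 (M n) * tailP L0 (ε n * M n)) atTop (𝓝 0) ∧
      Tendsto (fun n : ℕ => tailP H0 (M n) ^ (-(1 - β)) *
        (ell α H0 (γ * M n * (1 + ε n)) / ell α H0 (γ * M n) - 1)) atTop (𝓝 0) := by
  obtain ⟨A, hApos, hA, hsnd⟩ := hsnd
  have hβ0 : 0 < β := (le_max_right _ _).trans_lt hβl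
  have hβ1 : 1 - 1 / α < β := (le_max_left _ _).trans_lt hβl
  have h1β : 0 < 1 - β := by linarith
  set p : ℕ → ℝ := fun n => tailP H0 (M n) with hp
  set a := α * (1 - β) with ha
  have ha0 : 0 < a := mul_pos hα h1β
  have ha1 : a < 1 := by
    have : 1 - β < 1 / α := by linarith
    rwa [lt_div_iff₀' hα] at this
  have haρ : a < -(ρ * α) := by
    have h1 : 1 - β ≤ (1 - β) / β := le_div_self h1β.le hβ0 hβu.le
    nlinarith
  obtain ⟨σ, hσa, hσρ⟩ := exists_between haρ
  obtain ⟨δ, hδa, hδ1⟩ := exists_between ha1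
  have hanti := tailP_antitone H0
  have hFpos : ∀ t, 0 < tailP H0 t := by
    intro t
    obtain ⟨n, hn1, hn2⟩ :=
      ((hB.eventually_gt_atTop 0).and (hMtop.eventually_ge_atTop t)).exists
    exact (pos_of_mul_pos_right hn1 n.cast_nonneg).trans_le (hanti hn2)
  obtain ⟨T, K, hT, hK, hlog⟩ := exists_abs_log_sub_le_of_secondOrder hα hρ (ha0.trans hσa) hσρ
    hFpos hanti hreg hApos hA (hsnd 2 two_pos)
  have hellpos : ∀ t, 0 < t → 0 < t ^ α * tailP H0 t := fun t ht =>
    mul_pos (Real.rpow_pos_of_pos ht _) (hFpos t)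
  have hppos : ∀ n, 0 < p n := fun n => hFpos _
  -- the tail is bounded below by a multiple of `x ^ (-α)`
  obtain ⟨C, hC0, hpC⟩ : ∃ C : ℝ, 0 < C ∧ ∀ᶠ n in atTop, p n ^ (-(1 - β)) ≤ C * M n ^ a := by
    set c := Real.exp (Real.log (T ^ α * tailP H0 T) - K * T ^ (-σ)) with hc
    have hc0 : 0 < c := Real.exp_pos _
    refine ⟨c ^ (-(1 - β)), by positivity, ?_⟩
    filter_upwards [hMtop.eventually_ge_atTop T] with n hn
    have h1 := hlog T le_rfl (M n / T) ((one_le_div hT).2 hn)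
    rw [mul_div_cancel₀ _ hT.ne'] at h1
    have h2 : c ≤ M n ^ α * p n := by
      rw [hc, ← Real.le_log_iff_exp_le (hellpos _ (hMpos n))]
      linarith [(abs_le.1 h1).1]
    have h3 : c * M n ^ (-α) ≤ p n := by
      rw [Real.rpow_neg (hMpos n).le, ← div_eq_mul_inv,
        div_le_iff₀' (Real.rpow_pos_of_pos (hMpos n) _)]
      exact h2
    have h4 : 0 < M n ^ (-α) := Real.rpow_pos_of_pos (hMpos n) _
    calc p n ^ (-(1 - β)) ≤ (c * M n ^ (-α)) ^ (-(1 - β)) :=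
          Real.rpow_le_rpow_of_nonpos (mul_pos hc0 h4) h3 (by linarith)
      _ = c ^ (-(1 - β)) * M n ^ a := by
          rw [Real.mul_rpow hc0.le h4.le, ← Real.rpow_mul (hMpos n).le]
          congr 2
          rw [ha]; ring
  have hppow : ∀ n, 0 < p n ^ (-(1 - β)) := fun n => Real.rpow_pos_of_pos (hppos n) _
  have hdecay : ∀ s, a < s → Tendsto (fun n => p n ^ (-(1 - β)) * M n ^ (-s)) atTop (𝓝 0) := by
    intro s hs
    have h1 : Tendsto (fun n => C * M n ^ (-(s - a))) atTop (𝓝 0) := by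
      simpa using ((tendsto_rpow_neg_atTop (sub_pos.2 hs)).comp hMtop).const_mul C
    refine squeeze_zero' (Eventually.of_forall fun n => (mul_pos (hppow n)
      (Real.rpow_pos_of_pos (hMpos n) _)).le) ?_ h1
    filter_upwards [hpC] with n hn
    have h2 := Real.rpow_pos_of_pos (hMpos n) (-s)
    calc p n ^ (-(1 - β)) * M n ^ (-s) ≤ C * M n ^ a * M n ^ (-s) := by gcongr
      _ = C * M n ^ (-(s - a)) := by
          rw [mul_assoc, ← Real.rpow_add (hMpos n)]
          congr 2
          ring
  refine ⟨fun n => M n ^ (-δ), fun n => Real.rpow_pos_of_pos (hMpos n) _, hdecay δ hδa, ?_, ?_⟩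
  · obtain ⟨k, hk⟩ := exists_nat_ge (a / (1 - δ))
    rw [div_le_iff₀ (by linarith)] at hk
    set E := ∫ ω, L0 ω ^ k
    have hE : 0 ≤ E := integral_nonneg fun ω => pow_nonneg (hL0nn ω) k
    have hlim := hC.mul_const (C * E)
    rw [zero_mul] at hlim
    refine squeeze_zero' (Eventually.of_forall fun n => mul_nonneg
      (mul_nonneg n.cast_nonneg (hppos n).le) ENNReal.toReal_nonneg) ?_ hlim
    filter_upwards [hpC, hMtop.eventually_ge_atTop (Real.exp 1)] with n hn hM
    have hMn := hMpos n
    have hM1 : 1 ≤ M n := (Real.one_le_exp zero_le_one).trans hM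
    have hlog1 : 1 ≤ Real.log (M n) ^ 2 :=
      one_le_pow₀ ((Real.le_log_iff_exp_le hMn).2 hM)
    have hy : M n ^ (-δ) * M n = M n ^ (1 - δ) := by
      nth_rewrite 2 [← Real.rpow_one (M n)]
      rw [← Real.rpow_add hMn]
      congr 1
      ring
    have hypow : M n ^ a ≤ (M n ^ (1 - δ)) ^ k := by
      rw [← Real.rpow_mul_natCast hMn.le]
      exact Real.rpow_le_rpow_of_exponent_le hM1 (by linarith)
    have hL : tailP L0 (M n ^ (-δ) * M n) ≤ E / M n ^ a := by
      rw [hy]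
      refine (tailP_le_integral_pow_div hL0nn (hLmom k) (Real.rpow_pos_of_pos hMn _)).trans ?_
      exact div_le_div_of_nonneg_left hE (Real.rpow_pos_of_pos hMn _) hypow
    have hL0 : 0 ≤ tailP L0 (M n ^ (-δ) * M n) := ENNReal.toReal_nonneg
    have hprod : p n ^ (-(1 - β)) * tailP L0 (M n ^ (-δ) * M n) ≤ C * E := by
      have hMa := Real.rpow_pos_of_pos hMn a
      calc _ ≤ C * M n ^ a * (E / M n ^ a) := mul_le_mul hn hL hL0 (by positivity)
        _ = C * E := by field_simp
    have hsplit : p n = p n ^ (2 - β) * p n ^ (-(1 - β)) := by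
      rw [← Real.rpow_add (hppos n)]
      ring_nf
      exact (Real.rpow_one _).symm
    have hq : 0 ≤ (n : ℝ) * p n ^ (2 - β) :=
      mul_nonneg n.cast_nonneg (Real.rpow_pos_of_pos (hppos n) _).le
    calc (n : ℝ) * p n * tailP L0 (M n ^ (-δ) * M n)
        = (n : ℝ) * p n ^ (2 - β) * 1 *
            (p n ^ (-(1 - β)) * tailP L0 (M n ^ (-δ) * M n)) := by
          nth_rewrite 1 [hsplit]
          ring
      _ ≤ (n : ℝ) * p n ^ (2 - β) * Real.log (M n) ^ 2 * (C * E) := by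
          refine mul_le_mul (mul_le_mul_of_nonneg_left hlog1 hq) hprod
            (mul_nonneg (hppow n).le hL0) (mul_nonneg hq (sq_nonneg _))
  · have hγ0 := hγ.1
    have hγM : Tendsto (fun n => γ * M n) atTop atTop := hMtop.const_mul_atTop hγ0
    have hsmall : Tendsto (fun n => K * (γ * M n) ^ (-σ)) atTop (𝓝 0) := by
      simpa using ((tendsto_rpow_neg_atTop (ha0.trans hσa)).comp hγM).const_mul K
    have hlim := (hdecay σ hσa).const_mul (2 * K * γ ^ (-σ))
    rw [mul_zero] at hlim
    refine squeeze_zero_norm' ?_ hlim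
    filter_upwards [hγM.eventually_ge_atTop T, hsmall.eventually_le_const one_pos] with n h1 h2
    have hMn := hMpos n
    have h0 : 0 < γ * M n := mul_pos hγ0 hMn
    have hε : 0 < M n ^ (-δ) := Real.rpow_pos_of_pos hMn _
    have h3 := hlog _ h1 (1 + M n ^ (-δ)) (by linarith)
    have hl1 := hellpos _ h0
    have hl2 := hellpos (γ * M n * (1 + M n ^ (-δ))) (by positivity)
    rw [← Real.log_div hl2.ne' hl1.ne'] at h3
    have h4 := Real.abs_exp_sub_one_le (h3.trans h2)
    rw [Real.exp_log (div_pos hl2 hl1)] at h4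
    rw [norm_mul, Real.norm_eq_abs, Real.norm_eq_abs, abs_of_pos (hppow n)]
    calc _ ≤ p n ^ (-(1 - β)) * (2 * (K * (γ * M n) ^ (-σ))) :=
          mul_le_mul_of_nonneg_left (h4.trans (by linarith)) (hppow n).le
      _ = _ := by rw [Real.mul_rpow hγ0.le hMn.le]; ring
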